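/- Let k be a field and n ≥ 1. The ideal I_n of k[x_1,…,x_n] generated by positive-degree symmetric polynomials is mapped into itself by each multiplication operator X_i and each divided difference operator ∂_i; hence the polynomial representation of NH_n descends to an NH_n-module structure on L_n := k[x_1,…,x_n]/I_n, with x_i acting by multiplication and ∂_i acting by the induced divided difference operator. The resulting NH_n-module L_n is simple. -/

import Mathlib

open scoped TensorProduct

/-! ## The nilHecke algebra

For a field `k` and `N : ℕ`, the nilHecke algebra `NH k N` is the quotient of the free
associative `k`-algebra on generators `x_0, …, x_{N-1}` (indexed by `Fin N`) and
`∂_0, …, ∂_{N-2}` (indexed by `{i : Fin N // i + 1 < N}`) by the nilHecke relations. -/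

/-- Index type for the generators `∂_i` of the nilHecke algebra on `N` strands. -/
abbrev DIdx (N : ℕ) : Type := {i : Fin N // (i : ℕ) + 1 < N}

/-- The generators of the nilHecke algebra: `Sum.inl i` is `x_i`, `Sum.inr j` is `∂_j`. -/
abbrev NHGen (N : ℕ) : Type := Fin N ⊕ DIdx N

variable (k : Type) [Field k]

/-- `x_i` in the free algebra. -/
noncomputable abbrev NHx (N : ℕ) (i : Fin N) : FreeAlgebra k (NHGen N) :=
  FreeAlgebra.ι k (Sum.inl i)

/-- `∂_i` in the free algebra. -/
noncomputable abbrev NHd (N : ℕ) (i : DIdx N) : FreeAlgebra k (NHGen N) :=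
  FreeAlgebra.ι k (Sum.inr i)

/-- For `i` an index of a `∂` generator, the element `i+1` of `Fin N`. -/
abbrev DIdx.succ {N : ℕ} (i : DIdx N) : Fin N := ⟨(i.1 : ℕ) + 1, i.2⟩

/-- The defining relations of the nilHecke algebra:
`x_i x_j = x_j x_i`; `∂_i² = 0`; `∂_i ∂_{i+1} ∂_i = ∂_{i+1} ∂_i ∂_{i+1}`;
`∂_i ∂_j = ∂_j ∂_i` for `|i-j| > 1`; `x_i ∂_j = ∂_j x_i` for `|i-j| > 1`;
`x_i ∂_i - ∂_i x_{i+1} = 1`; `∂_i x_i - x_{i+1} ∂_i = 1`. -/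
inductive NHRel (N : ℕ) : FreeAlgebra k (NHGen N) → FreeAlgebra k (NHGen N) → Prop
  | xcomm (i j : Fin N) : NHRel N (NHx k N i * NHx k N j) (NHx k N j * NHx k N i)
  | dsq (i : DIdx N) : NHRel N (NHd k N i * NHd k N i) 0
  | braid (i j : DIdx N) (h : (j.1 : ℕ) = (i.1 : ℕ) + 1) :
      NHRel N (NHd k N i * NHd k N j * NHd k N i) (NHd k N j * NHd k N i * NHd k N j)
  | ddfar (i j : DIdx N) (h : (i.1 : ℕ) + 1 < (j.1 : ℕ) ∨ (j.1 : ℕ) + 1 < (i.1 : ℕ)) :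
      NHRel N (NHd k N i * NHd k N j) (NHd k N j * NHd k N i)
  | xdfar (i : Fin N) (j : DIdx N)
      (h : (i : ℕ) + 1 < (j.1 : ℕ) ∨ (j.1 : ℕ) + 1 < (i : ℕ)) :
      NHRel N (NHx k N i * NHd k N j) (NHd k N j * NHx k N i)
  | xd (i : DIdx N) :
      NHRel N (NHx k N i.1 * NHd k N i - NHd k N i * NHx k N i.succ) 1
  | dx (i : DIdx N) :
      NHRel N (NHd k N i * NHx k N i.1 - NHx k N i.succ * NHd k N i) 1

/-- The nilHecke algebra on `N` strands over `k`. -/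
noncomputable def NH (N : ℕ) : Type := RingQuot (NHRel k N)

noncomputable instance (N : ℕ) : Ring (NH k N) :=
  inferInstanceAs (Ring (RingQuot (NHRel k N)))

noncomputable instance (N : ℕ) : Algebra k (NH k N) :=
  inferInstanceAs (Algebra k (RingQuot (NHRel k N)))

/-- The generator `x_i` of the nilHecke algebra `NH k N`. -/
noncomputable def xg (N : ℕ) (i : Fin N) : NH k N :=
  RingQuot.mkAlgHom k (NHRel k N) (NHx k N i)

/-- The generator `∂_i` of the nilHecke algebra `NH k N`. -/
noncomputable def dg (N : ℕ) (i : DIdx N) : NH k N :=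
  RingQuot.mkAlgHom k (NHRel k N) (NHd k N i)



open MvPolynomial

/-! ## Divided differences -/

section DividedDifference

variable {σ : Type*} {k}

lemma X_sub_X_ne_zero {a b : σ} (hab : a ≠ b) :
    (X a - X b : MvPolynomial σ k) ≠ 0 := fun h => hab (X_injective (sub_eq_zero.mp h))

/-- The algebra endomorphism exchanging two variables. -/
noncomputable abbrev swapVars [DecidableEq σ] (a b : σ) :
    MvPolynomial σ k →ₐ[k] MvPolynomial σ k :=
  rename (Equiv.swap a b)

variable [DecidableEq σ]

lemma swapVars_swapVars (a b : σ) (f : MvPolynomial σ k) :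
    swapVars a b (swapVars a b f) = f := by
  rw [rename_rename, ← Equiv.coe_trans, Equiv.swap_swap]
  simp

lemma X_sub_X_dvd_sub_swapVars (a b : σ) (f : MvPolynomial σ k) :
    X a - X b ∣ f - swapVars a b f := by
  rw [← Ideal.mem_span_singleton, ← Ideal.Quotient.mk_eq_mk_iff_sub_mem]
  have hX : Ideal.Quotient.mk (Ideal.span {(X a - X b : MvPolynomial σ k)}) (X a) =
      Ideal.Quotient.mk _ (X b) :=
    Ideal.Quotient.mk_eq_mk_iff_sub_mem _ _ |>.mpr (Ideal.mem_span_singleton_self _)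
  have h : Ideal.Quotient.mkₐ k (Ideal.span {(X a - X b : MvPolynomial σ k)}) =
      (Ideal.Quotient.mkₐ k _).comp (swapVars a b) := by
    apply MvPolynomial.algHom_ext
    intro c
    simp only [AlgHom.comp_apply, rename_X, Ideal.Quotient.mkₐ_eq_mk]
    by_cases hca : c = a
    · subst hca; simpa using hX
    by_cases hcb : c = b
    · subst hcb; simpa using hX.symm
    rw [Equiv.swap_apply_of_ne_of_ne hca hcb]
  exact DFunLike.congr_fun h f

lemma exists_dividedDifference {a b : σ} (hab : a ≠ b) :
    ∃ D : Module.End k (MvPolynomial σ k),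
      ∀ f, (X a - X b) * D f = f - swapVars a b f := by
  choose D hD using X_sub_X_dvd_sub_swapVars (k := k) a b
  refine ⟨{ toFun := D, map_add' := fun f g => ?_, map_smul' := fun c f => ?_ },
    fun f => (hD f).symm⟩
  · apply mul_left_cancel₀ (X_sub_X_ne_zero (k := k) hab)
    rw [← hD, mul_add, ← hD, ← hD, map_add]
    ring
  · apply mul_left_cancel₀ (X_sub_X_ne_zero (k := k) hab)
    rw [← hD, RingHom.id_apply, mul_smul_comm, ← hD, map_smul, smul_sub]

/-- `D` is the divided difference operator in the variables `a` and `b`. -/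
def IsDividedDifference (a b : σ) (D : Module.End k (MvPolynomial σ k)) : Prop :=
  ∀ f, (X a - X b) * D f = f - swapVars a b f

namespace IsDividedDifference

variable {a b c e : σ} {D D' : Module.End k (MvPolynomial σ k)}

lemma unique (hab : a ≠ b) (h : IsDividedDifference a b D) (h' : IsDividedDifference a b D') :
    D = D' :=
  LinearMap.ext fun f => mul_left_cancel₀ (X_sub_X_ne_zero hab) ((h f).trans (h' f).symm)

lemma apply_eq_zero_iff (hab : a ≠ b) (h : IsDividedDifference a b D) (f : MvPolynomial σ k) :
    D f = 0 ↔ swapVars a b f = f := by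
  have := h f
  refine ⟨fun h0 => ?_, fun hs => ?_⟩
  · rw [h0, mul_zero] at this
    exact (sub_eq_zero.mp this.symm).symm
  · rw [hs, sub_self] at this
    exact (mul_eq_zero.mp this).resolve_left (X_sub_X_ne_zero hab)

lemma swapVars_apply (hab : a ≠ b) (h : IsDividedDifference a b D) (f : MvPolynomial σ k) :
    swapVars a b (D f) = D f := by
  have h1 := h f
  have h2 := congrArg (swapVars a b) h1
  simp only [map_mul, map_sub, swapVars_swapVars, rename_X, Equiv.swap_apply_left,
    Equiv.swap_apply_right] at h2
  apply mul_left_cancel₀ (X_sub_X_ne_zero hab)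
  linear_combination -h1 - h2

lemma apply_apply (hab : a ≠ b) (h : IsDividedDifference a b D) (f : MvPolynomial σ k) :
    D (D f) = 0 :=
  (h.apply_eq_zero_iff hab _).mpr (h.swapVars_apply hab f)

lemma apply_mul (hab : a ≠ b) (h : IsDividedDifference a b D) (f g : MvPolynomial σ k) :
    D (f * g) = D f * g + swapVars a b f * D g := by
  apply mul_left_cancel₀ (X_sub_X_ne_zero hab)
  have h1 := h (f * g)
  rw [map_mul (swapVars a b)] at h1
  linear_combination h1 - g * h f - swapVars a b f * h g

lemma apply_X_left (hab : a ≠ b) (h : IsDividedDifference a b D) : D (X a) = 1 := by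
  apply mul_left_cancel₀ (X_sub_X_ne_zero hab)
  rw [h, rename_X, Equiv.swap_apply_left, mul_one]

lemma apply_X_right (hab : a ≠ b) (h : IsDividedDifference a b D) : D (X b) = -1 := by
  apply mul_left_cancel₀ (X_sub_X_ne_zero hab)
  rw [h, rename_X, Equiv.swap_apply_right]
  ring

lemma apply_X_of_ne (hab : a ≠ b) (h : IsDividedDifference a b D) (hca : c ≠ a) (hcb : c ≠ b) :
    D (X c) = 0 := by
  rw [h.apply_eq_zero_iff hab, rename_X, Equiv.swap_apply_of_ne_of_ne hca hcb]

lemma commute (hab : a ≠ b) (hce : c ≠ e) (hac : a ≠ c) (hae : a ≠ e) (hbc : b ≠ c)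
    (hbe : b ≠ e) (h : IsDividedDifference a b D) (h' : IsDividedDifference c e D')
    (f : MvPolynomial σ k) : D (D' f) = D' (D f) := by
  apply mul_left_cancel₀ (mul_ne_zero (X_sub_X_ne_zero hab) (X_sub_X_ne_zero (k := k) hce))
  have h1 := congrArg (swapVars a b) (h' f)
  have h2 := congrArg (swapVars c e) (h f)
  have hst : swapVars a b (swapVars c e f) = swapVars c e (swapVars a b f) := by
    rw [rename_rename, rename_rename]
    congr 2
    exact congrArg DFunLike.coe
      (Equiv.Perm.Disjoint.commute (Equiv.Perm.disjoint_swap_swap (by simp [*]))).eq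
  simp only [map_mul, map_sub, rename_X, Equiv.swap_apply_of_ne_of_ne hac.symm hbc.symm,
    Equiv.swap_apply_of_ne_of_ne hae.symm hbe.symm] at h1
  simp only [map_mul, map_sub, rename_X, Equiv.swap_apply_of_ne_of_ne hac hae,
    Equiv.swap_apply_of_ne_of_ne hbc hbe] at h2
  linear_combination (X c - X e) * h (D' f) - (X a - X b) * h' (D f) + h' f - h f - h1 + h2 + hst

lemma braid (hab : a ≠ b) (hbc : b ≠ c) (hac : a ≠ c)
    (h : IsDividedDifference a b D) (h' : IsDividedDifference b c D')
    (f : MvPolynomial σ k) : D (D' (D f)) = D' (D (D' f)) := by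
  apply mul_left_cancel₀ (mul_ne_zero (mul_ne_zero (X_sub_X_ne_zero hab)
    (X_sub_X_ne_zero (k := k) hbc)) (X_sub_X_ne_zero (k := k) hac))
  have sa : Equiv.swap a b a = b := Equiv.swap_apply_left _ _
  have sb : Equiv.swap a b b = a := Equiv.swap_apply_right _ _
  have sc : Equiv.swap a b c = c := Equiv.swap_apply_of_ne_of_ne hac.symm hbc.symm
  have ta : Equiv.swap b c a = a := Equiv.swap_apply_of_ne_of_ne hab hac
  have tb : Equiv.swap b c b = c := Equiv.swap_apply_left _ _
  have tc : Equiv.swap b c c = b := Equiv.swap_apply_right _ _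
  have hst : swapVars a b (swapVars b c (swapVars a b f)) =
      swapVars b c (swapVars a b (swapVars b c f)) := by
    simp only [rename_rename]
    congr 2
    funext x
    simp only [Function.comp_apply]
    by_cases hxa : x = a
    · subst hxa; simp only [sa, sc, ta, tb]
    by_cases hxb : x = b
    · subst hxb; simp only [sa, sb, sc, ta, tb, tc]
    by_cases hxc : x = c
    · subst hxc; simp only [sb, sc, ta, tc]
    simp only [Equiv.swap_apply_of_ne_of_ne hxa hxb, Equiv.swap_apply_of_ne_of_ne hxb hxc]
  have g1 := h (D' (D f))
  have g2 := h' (D f)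
  have g3 := congrArg (swapVars a b) g2
  have g4 := h f
  have g5 := congrArg (swapVars b c) g4
  have g6 := congrArg (swapVars a b) g5
  have g7 := h.swapVars_apply hab f
  have k1 := h' (D (D' f))
  have k2 := h (D' f)
  have k3 := congrArg (swapVars b c) k2
  have k4 := h' f
  have k5 := congrArg (swapVars a b) k4
  have k6 := congrArg (swapVars b c) k5
  have k7 := h'.swapVars_apply hbc f
  simp only [map_mul, map_sub, rename_X, sa, sb, sc, ta, tb, tc] at g3 g5 g6 k3 k5 k6
  linear_combination (X b - X c) * (X a - X c) * g1 + (X a - X c) * g2 - (X b - X c) * g3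
    - (X b - X c) * g7 + g4 - g5 + g6
    - (X a - X b) * (X a - X c) * k1 - (X a - X c) * k2 + (X a - X b) * k3
    + (X a - X b) * k7 - k4 + k5 - k6 - hst

lemma totalDegree_lt (hab : a ≠ b) (h : IsDividedDifference a b D) {f : MvPolynomial σ k}
    (hf : D f ≠ 0) : (D f).totalDegree < f.totalDegree := by
  have h1 := congrArg totalDegree (h f)
  rw [totalDegree_mul_of_isDomain (X_sub_X_ne_zero hab) hf] at h1
  have h2 : (f - swapVars a b f).totalDegree ≤ f.totalDegree :=
    (totalDegree_sub _ _).trans (max_le le_rfl (totalDegree_rename_le _ _))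
  have h3 : (X a - X b : MvPolynomial σ k).totalDegree ≠ 0 := by
    intro h0
    rw [totalDegree_eq_zero_iff_eq_C] at h0
    exact X_sub_X_ne_zero (k := k) hab (by simpa using h0)
  omega

end IsDividedDifference

end DividedDifference

/-! ## Divided differences in consecutive variables -/

section DivDiff

variable {k} {n : ℕ}

/-- The operator `∂_j` on `k[x_0, …, x_{n-1}]`, with value `0` when `j + 1 ≥ n`. -/
noncomputable def divDiff (j : ℕ) : Module.End k (MvPolynomial (Fin n) k) :=
  if h : j + 1 < n then
    (exists_dividedDifference (k := k) (a := (⟨j, by omega⟩ : Fin n)) (b := ⟨j + 1, h⟩)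
      (by simp)).choose
  else 0

lemma isDividedDifference_divDiff {j : ℕ} (h : j + 1 < n) :
    IsDividedDifference (k := k) ⟨j, by omega⟩ (⟨j + 1, h⟩ : Fin n) (divDiff j) := by
  rw [divDiff, dif_pos h]
  exact (exists_dividedDifference (by simp)).choose_spec

lemma divDiff_of_le {j : ℕ} (h : n ≤ j + 1) : divDiff (k := k) (n := n) j = 0 :=
  dif_neg (by omega)

lemma divDiff_mul_self (j : ℕ) : divDiff (k := k) (n := n) j * divDiff j = 0 := by
  by_cases h : j + 1 < n
  · exact LinearMap.ext fun f => (isDividedDifference_divDiff h).apply_apply (by simp) f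
  · rw [divDiff_of_le (by omega), mul_zero]

lemma divDiff_comm {i j : ℕ} (hij : i + 1 < j) :
    divDiff (k := k) (n := n) i * divDiff j = divDiff j * divDiff i := by
  by_cases h : j + 1 < n
  · refine LinearMap.ext fun f => (isDividedDifference_divDiff (show i + 1 < n by omega)).commute
      ?_ ?_ ?_ ?_ ?_ ?_ (isDividedDifference_divDiff h) f <;>
    simp only [ne_eq, Fin.mk.injEq] <;> omega
  · rw [divDiff_of_le (j := j) (by omega), mul_zero, zero_mul]

lemma divDiff_braid (i : ℕ) :
    divDiff (k := k) (n := n) i * divDiff (i + 1) * divDiff i =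
      divDiff (i + 1) * divDiff i * divDiff (i + 1) := by
  by_cases h : i + 1 + 1 < n
  · refine LinearMap.ext fun f => (isDividedDifference_divDiff (show i + 1 < n by omega)).braid
      ?_ ?_ ?_ (isDividedDifference_divDiff h) f <;>
    simp only [ne_eq, Fin.mk.injEq] <;> omega
  · rw [divDiff_of_le (j := i + 1) (by omega), mul_zero, zero_mul, mul_zero]

lemma divDiff_mul_sub_mem (J : Ideal (MvPolynomial (Fin n) k)) (j : ℕ)
    {f : MvPolynomial (Fin n) k} (hf : divDiff j f ∈ J) (g : MvPolynomial (Fin n) k) :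
    divDiff j (g * f) - divDiff j g * f ∈ J := by
  by_cases h : j + 1 < n
  · rw [(isDividedDifference_divDiff h).apply_mul (by simp), add_sub_cancel_left]
    exact J.mul_mem_left _ hf
  · simp [divDiff_of_le (k := k) (n := n) (j := j) (by omega)]

/-- Products of divided differences are linear, modulo a stable ideal, over elements whose
divided differences lie in that ideal. -/
lemma apply_mul_sub_mem_of_mem_closure {S : Set ℕ} {T : Module.End k (MvPolynomial (Fin n) k)}
    (hT : T ∈ Submonoid.closure (divDiff '' S)) (J : Ideal (MvPolynomial (Fin n) k))
    (hJ : ∀ j, ∀ f ∈ J, divDiff j f ∈ J)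
    {f : MvPolynomial (Fin n) k} (hf : ∀ j ∈ S, divDiff j f ∈ J) (g : MvPolynomial (Fin n) k) :
    T (g * f) - T g * f ∈ J := by
  induction hT using Submonoid.closure_induction_left with
  | one => simp
  | mul_left x hx T hT ih =>
    obtain ⟨j, hj, rfl⟩ := hx
    have h1 := hJ j _ ih
    have h2 := divDiff_mul_sub_mem J j (hf j hj) (T g)
    rw [map_sub] at h1
    simpa [Module.End.mul_apply] using J.add_mem h1 h2

/-- The product `∂_0 ∂_1 ⋯ ∂_{m-1}`. -/
noncomputable def divDiffChain : ℕ → Module.End k (MvPolynomial (Fin n) k)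
  | 0 => 1
  | m + 1 => divDiffChain m * divDiff m

/-- The divided difference operator of the longest permutation of the first `m` variables. -/
noncomputable def divDiffLongest : ℕ → Module.End k (MvPolynomial (Fin n) k)
  | 0 => 1
  | m + 1 => divDiffChain m * divDiffLongest m

lemma divDiff_mul_chain_of_lt {i m : ℕ} (h : m < i) :
    divDiff (k := k) (n := n) i * divDiffChain m = divDiffChain m * divDiff i := by
  induction m with
  | zero => simp [divDiffChain]
  | succ m ih =>
    rw [divDiffChain, ← mul_assoc, ih (by omega), mul_assoc, mul_assoc, ← divDiff_comm h]

lemma divDiff_zero_mul_chain (m : ℕ) :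
    divDiff (k := k) (n := n) 0 * divDiffChain (m + 1) = 0 := by
  induction m with
  | zero => simp [divDiffChain, divDiff_mul_self]
  | succ m ih => rw [divDiffChain, ← mul_assoc, ih, zero_mul]

lemma divDiff_succ_mul_chain {i m : ℕ} (h : i + 1 < m) :
    divDiff (k := k) (n := n) (i + 1) * divDiffChain m = divDiffChain m * divDiff i := by
  induction m with
  | zero => omega
  | succ m ih =>
    rcases Nat.lt_succ_iff_lt_or_eq.mp h with h | rfl
    · rw [divDiffChain, ← mul_assoc, ih h, mul_assoc, mul_assoc, divDiff_comm h]
    · rw [divDiffChain, divDiffChain, ← mul_assoc, ← mul_assoc,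
        divDiff_mul_chain_of_lt (Nat.lt_succ_self i)]
      simp only [mul_assoc]
      rw [← mul_assoc (divDiff i), divDiff_braid, mul_assoc]

lemma divDiff_mul_longest {i m : ℕ} (h : i + 1 < m) :
    divDiff (k := k) (n := n) i * divDiffLongest m = 0 := by
  induction m generalizing i with
  | zero => omega
  | succ m ih =>
    rw [divDiffLongest, ← mul_assoc]
    cases i with
    | zero =>
      obtain ⟨m, rfl⟩ : ∃ l, m = l + 1 := ⟨m - 1, by omega⟩
      rw [divDiff_zero_mul_chain, zero_mul]
    | succ i => rw [divDiff_succ_mul_chain (by omega), mul_assoc, ih (by omega), mul_zero]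

lemma divDiffChain_mem_closure (m : ℕ) :
    divDiffChain (k := k) (n := n) m ∈ Submonoid.closure (divDiff '' {j | j < m}) := by
  induction m with
  | zero => exact one_mem _
  | succ m ih =>
    refine mul_mem (Submonoid.closure_mono (Set.image_mono fun j hj => ?_) ih)
      (Submonoid.subset_closure ⟨m, Nat.lt_succ_self m, rfl⟩)
    exact Nat.lt_succ_of_lt hj

lemma divDiffLongest_mem_closure (m : ℕ) :
    divDiffLongest (k := k) (n := n) m ∈ Submonoid.closure (divDiff '' {j | j + 1 < m}) := by
  induction m with
  | zero => exact one_mem _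
  | succ m ih =>
    refine mul_mem (Submonoid.closure_mono (Set.image_mono fun j hj => ?_)
      (divDiffChain_mem_closure m)) (Submonoid.closure_mono (Set.image_mono fun j hj => ?_) ih)
    · exact Nat.succ_lt_succ hj
    · exact Nat.lt_succ_of_lt hj

variable (k n) in
/-- The product of the first `m` variables. -/
noncomputable def prodVars (m : ℕ) : MvPolynomial (Fin n) k :=
  ∏ i : Fin n with i.1 < m, X i

lemma prodVars_succ {m : ℕ} (h : m < n) :
    prodVars k n (m + 1) = X ⟨m, h⟩ * prodVars k n m := by
  rw [prodVars, prodVars, ← Finset.prod_insert (by simp)]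
  congr 1
  ext i
  simp only [Finset.mem_filter, Finset.mem_univ, true_and, Finset.mem_insert, Fin.ext_iff]
  omega

lemma divDiff_prodVars {j m : ℕ} (h : j + 1 ≠ m) : divDiff j (prodVars k n m) = 0 := by
  by_cases hj : j + 1 < n
  · rw [(isDividedDifference_divDiff hj).apply_eq_zero_iff (by simp), prodVars, map_prod]
    refine Finset.prod_equiv (Equiv.swap _ _) (fun i => ?_) (fun i _ => rename_X _ _)
    simp only [Finset.mem_filter, Finset.mem_univ, true_and]
    rw [Equiv.swap_apply_def]
    split_ifs with h1 h2
    · subst h1; simp only; omega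
    · subst h2; simp only; omega
    · rfl
  · rw [divDiff_of_le (by omega), LinearMap.zero_apply]

lemma divDiffChain_prodVars {m : ℕ} (h : m < n) : divDiffChain m (prodVars k n m) = 1 := by
  induction m with
  | zero => simp [divDiffChain, prodVars]
  | succ m ih =>
    have hd := isDividedDifference_divDiff (k := k) h
    rw [divDiffChain, Module.End.mul_apply, prodVars_succ (by omega), hd.apply_mul (by simp),
      hd.apply_X_left (by simp), divDiff_prodVars (by omega), one_mul, mul_zero, add_zero,
      ih (by omega)]

lemma exists_divDiffLongest_eq_one {m : ℕ} (h : m ≤ n) :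
    ∃ g : MvPolynomial (Fin n) k, divDiffLongest m g = 1 := by
  induction m with
  | zero => exact ⟨1, rfl⟩
  | succ m ih =>
    obtain ⟨g, hg⟩ := ih (by omega)
    refine ⟨g * prodVars k n m, ?_⟩
    have := apply_mul_sub_mem_of_mem_closure (divDiffLongest_mem_closure m)
      (⊥ : Ideal (MvPolynomial (Fin n) k)) (by simp) (f := prodVars k n m)
      (fun j hj => divDiff_prodVars (ne_of_lt hj)) g
    rw [Ideal.mem_bot, sub_eq_zero, hg, one_mul] at this
    rw [divDiffLongest, Module.End.mul_apply, this, divDiffChain_prodVars h]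

lemma isSymmetric_of_divDiff_eq_zero {f : MvPolynomial (Fin n) k}
    (hf : ∀ j, j + 1 < n → divDiff j f = 0) : f.IsSymmetric := by
  intro e
  cases n with
  | zero => rw [Subsingleton.elim e 1]; simp
  | succ n =>
    have he : e ∈ Submonoid.closure
        (Set.range fun i : Fin n => Equiv.swap i.castSucc i.succ) := by
      rw [Equiv.Perm.mclosure_swap_castSucc_succ]; trivial
    induction he using Submonoid.closure_induction with
    | mem x hx =>
      obtain ⟨i, rfl⟩ := hx
      have hi : i.1 + 1 < n + 1 := by omega
      exact ((isDividedDifference_divDiff hi).apply_eq_zero_iff (by simp) f).mp (hf _ hi)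
    | one => simp
    | mul x y _ _ hx hy => rw [Equiv.Perm.coe_mul, ← rename_rename, hy, hx]

lemma isSymmetric_divDiffLongest (f : MvPolynomial (Fin n) k) :
    (divDiffLongest n f).IsSymmetric :=
  isSymmetric_of_divDiff_eq_zero fun _ hj => LinearMap.congr_fun (divDiff_mul_longest hj) f

end DivDiff

/-! ## The coinvariant ideal -/

section Coinvariant

variable {k} {n : ℕ}

variable (k n) in
/-- The ideal generated by the symmetric polynomials with zero constant term. -/
noncomputable def coinvariantIdeal : Ideal (MvPolynomial (Fin n) k) :=
  Ideal.span {f : MvPolynomial (Fin n) k | f.IsSymmetric ∧ constantCoeff f = 0}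

lemma divDiff_mem_coinvariantIdeal (j : ℕ) {f : MvPolynomial (Fin n) k}
    (hf : f ∈ coinvariantIdeal k n) : divDiff j f ∈ coinvariantIdeal k n := by
  by_cases h : j + 1 < n
  · have hd := isDividedDifference_divDiff (k := k) h
    rw [coinvariantIdeal] at hf
    induction hf using Submodule.span_induction with
    | mem x hx => simp [(hd.apply_eq_zero_iff (by simp) x).mpr (hx.1 _)]
    | zero => simp
    | add x y _ _ hx hy => rw [map_add]; exact add_mem hx hy
    | smul a x hx ih =>
      rw [smul_eq_mul, hd.apply_mul (by simp)]
      exact add_mem (Ideal.mul_mem_left _ _ hx) (Ideal.mul_mem_left _ _ ih)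
  · simp [divDiff_of_le (k := k) (n := n) (j := j) (by omega)]

lemma coinvariantIdeal_ne_top : coinvariantIdeal k n ≠ ⊤ := by
  have h : coinvariantIdeal k n ≤ RingHom.ker (constantCoeff (σ := Fin n) (R := k)) :=
    Ideal.span_le.mpr fun f hf => hf.2
  exact fun htop => RingHom.ker_ne_top _ (top_le_iff.mp (htop ▸ h))

/-- The coinvariant ideal is the largest proper ideal stable under divided differences. -/
lemma le_coinvariantIdeal {J : Ideal (MvPolynomial (Fin n) k)} (hJ : J ≠ ⊤)
    (hle : coinvariantIdeal k n ≤ J) (hstab : ∀ j, ∀ f ∈ J, divDiff j f ∈ J) :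
    J ≤ coinvariantIdeal k n := by
  suffices ∀ d, ∀ f ∈ J, f.totalDegree = d → f ∈ coinvariantIdeal k n from
    fun f hf => this _ f hf rfl
  intro d
  induction d using Nat.strong_induction_on with
  | _ d ih =>
    rintro f hf rfl
    have hdf : ∀ j, divDiff j f ∈ coinvariantIdeal k n := by
      intro j
      by_cases h0 : divDiff j f = 0
      · simp [h0]
      · have h : j + 1 < n := by
          by_contra h
          exact h0 (by rw [divDiff_of_le (by omega), LinearMap.zero_apply])
        exact ih _ ((isDividedDifference_divDiff h).totalDegree_lt (by simp) h0) _
          (hstab j f hf) rfl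
    obtain ⟨g, hg⟩ := exists_divDiffLongest_eq_one (k := k) (le_refl n)
    have hsub := apply_mul_sub_mem_of_mem_closure (divDiffLongest_mem_closure n)
      (coinvariantIdeal k n) (fun j f => divDiff_mem_coinvariantIdeal j)
      (fun j _ => hdf j) g
    rw [hg, one_mul] at hsub
    set F := divDiffLongest n (g * f)
    have hFJ : F ∈ J := by
      simpa using J.add_mem (hle hsub) hf
    have hFC : F - C (constantCoeff F) ∈ coinvariantIdeal k n :=
      Ideal.subset_span ⟨(isSymmetric_divDiffLongest _).sub (IsSymmetric.C _), by simp⟩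
    have hC : C (constantCoeff F) ∈ J := by
      simpa using J.sub_mem hFJ (hle hFC)
    have hc : constantCoeff F = 0 := by
      by_contra hc
      exact hJ (J.eq_top_of_isUnit_mem hC ((isUnit_iff_ne_zero.mpr hc).map C))
    rw [hc, map_zero, sub_zero] at hFC
    simpa using sub_mem hFC hsub

end Coinvariant

lemma Ideal.exists_quotient_end {A : Type*} [CommRing A] [Algebra k A] (I : Ideal A)
    (T : Module.End k A) (hT : ∀ f ∈ I, T f ∈ I) :
    ∃ T' : Module.End k (A ⧸ I), ∀ f, T' (Ideal.Quotient.mk I f) = Ideal.Quotient.mk I (T f) :=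
  ⟨(Submodule.mapQ (I.restrictScalars k) (I.restrictScalars k) T hT :), fun _ => rfl⟩

/-- for a field `k` and `n ≥ 1`, the ideal `I_n` of `k[x_1,…,x_n]`
generated by symmetric polynomials with zero constant term is stable under each
multiplication operator `X_i` and each divided difference operator `∂_i`
(characterized by `(x_i - x_{i+1})·∂_i f = f - s_i f`); hence the polynomial
representation descends to an `NH_n`-module structure on `L_n := k[x_1,…,x_n]/I_n`,
with `x_i` acting by multiplication and `∂_i` by the induced divided difference
operator, and the resulting `NH_n`-module `L_n` is simple (it is nonzero and every
`k`-subspace stable under the `NH_n`-action is `⊥` or `⊤`). -/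
theorem stmt_9 (n : ℕ) (hn : 1 ≤ n)
    (I : Ideal (MvPolynomial (Fin n) k))
    (hI : I = Ideal.span {f : MvPolynomial (Fin n) k |
        f.IsSymmetric ∧ constantCoeff f = 0}) :
    (∀ (i : Fin n), ∀ f ∈ I, X i * f ∈ I) ∧
    (∀ (j : DIdx n) (D : Module.End k (MvPolynomial (Fin n) k)),
      (∀ f, (X j.1 - X j.succ) * D f = f - rename (Equiv.swap j.1 j.succ) f) →
      ∀ f ∈ I, D f ∈ I) ∧
    (∃ ρ : NH k n →ₐ[k] Module.End k (MvPolynomial (Fin n) k ⧸ I),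
      (∀ i : Fin n, ρ (xg k n i)
          = LinearMap.mulLeft k (Ideal.Quotient.mk I (X i))) ∧
      (∀ (j : DIdx n) (D : Module.End k (MvPolynomial (Fin n) k)),
        (∀ f, (X j.1 - X j.succ) * D f = f - rename (Equiv.swap j.1 j.succ) f) →
        ∀ f : MvPolynomial (Fin n) k,
          ρ (dg k n j) (Ideal.Quotient.mk I f) = Ideal.Quotient.mk I (D f)) ∧
      Nontrivial (MvPolynomial (Fin n) k ⧸ I) ∧
      (∀ W : Submodule k (MvPolynomial (Fin n) k ⧸ I),
        (∀ (a : NH k n), ∀ x ∈ W, ρ a x ∈ W) → W = ⊥ ∨ W = ⊤)) := by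
  have hI' : I = coinvariantIdeal k n := hI
  have hD (j : DIdx n) (D : Module.End k (MvPolynomial (Fin n) k))
      (h : ∀ f, (X j.1 - X j.succ) * D f = f - rename (Equiv.swap j.1 j.succ) f) :
      D = divDiff j.1 :=
    IsDividedDifference.unique (by simp [Fin.ext_iff]) h (isDividedDifference_divDiff j.2)
  have hne (j : DIdx n) : j.1 ≠ j.succ := by simp [Fin.ext_iff]
  have hstab : ∀ j : ℕ, ∀ f ∈ I, divDiff j f ∈ I := by
    rw [hI']
    exact fun j f => divDiff_mem_coinvariantIdeal j
  refine ⟨fun i f hf => I.mul_mem_left _ hf, fun j D h f hf => hD j D h ▸ hstab _ f hf, ?_⟩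
  choose d hd using fun j : DIdx n => I.exists_quotient_end k (divDiff j.1) (hstab j.1)
  let φ : FreeAlgebra k (NHGen n) →ₐ[k] Module.End k (MvPolynomial (Fin n) k ⧸ I) :=
    FreeAlgebra.lift k
      (Sum.elim (fun i => LinearMap.mulLeft k (Ideal.Quotient.mk I (X i))) d)
  have hφx (i : Fin n) : φ (NHx k n i) = LinearMap.mulLeft k (Ideal.Quotient.mk I (X i)) := by
    simp [φ]
  have hφd (j : DIdx n) : φ (NHd k n j) = d j := by simp [φ]
  have hleib (j : DIdx n) := (isDividedDifference_divDiff (k := k) j.2).apply_mul (hne j)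
  have hφ : ∀ ⦃a b⦄, NHRel k n a b → φ a = φ b := by
    intro a b hab
    refine LinearMap.ext fun q => ?_
    obtain ⟨f, rfl⟩ := Ideal.Quotient.mk_surjective q
    induction hab with
    | xcomm i j =>
      simp only [map_mul, hφx, Module.End.mul_apply, LinearMap.mulLeft_apply, mul_left_comm]
    | dsq i =>
      simp only [map_mul, hφd, Module.End.mul_apply, hd, map_zero, LinearMap.zero_apply]
      rw [← Module.End.mul_apply, divDiff_mul_self]
      simp
    | braid i j h =>
      simp only [map_mul, hφd, Module.End.mul_apply, hd, h]
      exact congrArg _ (LinearMap.congr_fun (divDiff_braid i.1.1) f)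
    | ddfar i j h =>
      simp only [map_mul, hφd, Module.End.mul_apply, hd]
      rcases h with h | h
      · exact congrArg _ (LinearMap.congr_fun (divDiff_comm h) f)
      · exact congrArg _ (LinearMap.congr_fun (divDiff_comm h).symm f)
    | xdfar i j h =>
      have h1 : i ≠ j.1 := by rw [ne_eq, Fin.ext_iff]; omega
      have h2 : i ≠ j.succ := by simp only [ne_eq, Fin.ext_iff]; omega
      simp only [map_mul, hφx, hφd, Module.End.mul_apply, LinearMap.mulLeft_apply, hd]
      simp only [← map_mul, hd]
      rw [hleib, (isDividedDifference_divDiff j.2).apply_X_of_ne (hne j) h1 h2, rename_X,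
        Equiv.swap_apply_of_ne_of_ne h1 h2, zero_mul, zero_add]
    | xd i =>
      simp only [map_mul, map_sub, map_one, hφx, hφd, Module.End.mul_apply, LinearMap.sub_apply,
        LinearMap.mulLeft_apply, hd, Module.End.one_apply]
      simp only [← map_mul, ← map_sub, hd]
      rw [hleib, (isDividedDifference_divDiff i.2).apply_X_right (hne i), rename_X,
        Equiv.swap_apply_right]
      congr 1
      ring
    | dx i =>
      simp only [map_mul, map_sub, map_one, hφx, hφd, Module.End.mul_apply, LinearMap.sub_apply,
        LinearMap.mulLeft_apply, hd, Module.End.one_apply]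
      simp only [← map_mul, ← map_sub, hd]
      rw [hleib, (isDividedDifference_divDiff i.2).apply_X_left (hne i), rename_X,
        Equiv.swap_apply_left]
      congr 1
      ring
  let ρ : NH k n →ₐ[k] Module.End k (MvPolynomial (Fin n) k ⧸ I) :=
    RingQuot.liftAlgHom k ⟨φ, hφ⟩
  have hρx (i : Fin n) : ρ (xg k n i) = LinearMap.mulLeft k (Ideal.Quotient.mk I (X i)) :=
    (RingQuot.liftAlgHom_mkAlgHom_apply k φ hφ _).trans (hφx i)
  have hρd (j : DIdx n) : ρ (dg k n j) = d j :=
    (RingQuot.liftAlgHom_mkAlgHom_apply k φ hφ _).trans (hφd j)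
  refine ⟨ρ, hρx, fun j D h f => ?_, ?_, fun W hW => ?_⟩
  · rw [hρd, hd, hD j D h]
  · exact Ideal.Quotient.nontrivial_iff.mpr (hI' ▸ coinvariantIdeal_ne_top)
  let J : Ideal (MvPolynomial (Fin n) k) :=
    { carrier := {f | Ideal.Quotient.mk I f ∈ W}
      add_mem' := fun {f g} hf hg => by
        simpa only [Set.mem_ofPred_eq, map_add] using W.add_mem hf hg
      zero_mem' := by simp
      smul_mem' := fun g f hf => by
        simp only [Set.mem_ofPred_eq, smul_eq_mul] at hf ⊢
        induction g using MvPolynomial.induction_on generalizing f with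
        | C c =>
          rw [← smul_eq_C_mul]
          exact W.smul_mem c hf
        | add p q hp hq => simpa only [add_mul, map_add] using W.add_mem (hp f hf) (hq f hf)
        | mul_X p i hp =>
          rw [mul_assoc]
          refine hp _ ?_
          have := hW (xg k n i) _ hf
          rwa [hρx, LinearMap.mulLeft_apply, ← map_mul] at this }
  have hJ (f : MvPolynomial (Fin n) k) : f ∈ J ↔ Ideal.Quotient.mk I f ∈ W := Iff.rfl
  by_cases htop : J = ⊤
  · right
    refine eq_top_iff.mpr fun q _ => ?_
    obtain ⟨f, rfl⟩ := Ideal.Quotient.mk_surjective q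
    exact (hJ f).mp (htop ▸ Submodule.mem_top)
  · left
    refine eq_bot_iff.mpr fun q hq => ?_
    obtain ⟨f, rfl⟩ := Ideal.Quotient.mk_surjective q
    have hle : J ≤ coinvariantIdeal k n := by
      refine le_coinvariantIdeal htop (fun f hf => ?_) fun j f hf => ?_
      · rw [hJ, Ideal.Quotient.eq_zero_iff_mem.mpr (hI' ▸ hf)]
        exact W.zero_mem
      · by_cases h : j + 1 < n
        · have := hW (dg k n ⟨⟨j, by omega⟩, h⟩) _ hf
          rwa [hρd, hd] at this
        · rw [divDiff_of_le (by omega), LinearMap.zero_apply]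
          exact J.zero_mem
    exact (Submodule.mem_bot k).mpr (Ideal.Quotient.eq_zero_iff_mem.mpr (hI' ▸ hle hq))
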